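/- Let ~ be an algebraic word relation. Call [w,n] ∈ 𝕎 reduced if w is reduced, let W_R^(~) ⊆ W be the k-linear span of all reduced basis elements [w,n], and let K_R^(~) ⊆ W_R^(~) be the span of the finite sums κ_E^n = Σ_{w∈E} [w,n] where E is the set of reduced words in a single ~-equivalence class of words with letters in {1,...,n}. Then both W_R^(~) and K_R^(~) are sub-bialgebras of W: each contains [∅,0], is closed under ∇⧢, and is mapped by Δ⊙ into its own tensor square. -/

import Mathlib

abbrev Word : Type := List ℕ+

def maxLetter (w : Word) : ℕ := w.foldr (fun a n => max (a : ℕ) n) 0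

open Classical in
noncomputable def wRestrict (w : Word) (S : Set ℕ+) : Word :=
  w.filter fun a => decide (a ∈ S)

def wUp (m : ℕ) (w : Word) : Word :=
  w.map fun (a : ℕ+) => ⟨(a : ℕ) + m, Nat.add_pos_left a.pos m⟩

open scoped TensorProduct

/-- The basis set `𝕎`: pairs `[w,n]` with `max(w) ≤ n`. -/
def WIdx : Type := {p : Word × ℕ // ∀ a ∈ p.1, (a : ℕ) ≤ p.2}

/-- `W`: the free `k`-vector space on `𝕎`. -/
abbrev WSpace (k : Type*) [Field k] : Type _ := WIdx →₀ k

variable (k : Type*) [Field k]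

/-- `u` is a shuffle of `v` and `w ↑ m`:
`u ∩ {1,…,m} = v`, `u ∩ {m+1,…,m+n} = w ↑ m` and `ℓ(u) = ℓ(v) + ℓ(w)`. -/
def IsShuffle (m n : ℕ) (v w u : Word) : Prop :=
  wRestrict u {a : ℕ+ | (a : ℕ) ≤ m} = v ∧
  wRestrict u {a : ℕ+ | m < (a : ℕ) ∧ (a : ℕ) ≤ m + n} = wUp m w ∧
  u.length = v.length + w.length

/-- `∇⧢([v,m] ⊗ [w,n]) = Σ_u [u, m+n]` over all shuffles `u` of `v` and `w ↑ m`. -/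
noncomputable def shufProd (p q : WIdx) : WSpace k :=
  ∑ᶠ (u : WIdx) (_ : u.1.2 = p.1.2 + q.1.2 ∧ IsShuffle p.1.2 q.1.2 p.1.1 q.1.1 u.1.1),
    Finsupp.single u 1

/-- The shifted shuffle product `∇⧢` as a bilinear map. -/
noncomputable def mulW : WSpace k →ₗ[k] WSpace k →ₗ[k] WSpace k :=
  Finsupp.lift (WSpace k →ₗ[k] WSpace k) k WIdx fun p =>
    Finsupp.lift (WSpace k) k WIdx fun q => shufProd k p q

/-- `Δ⊙([w,n]) = Σ_i [w₁⋯wᵢ, n] ⊗ [wᵢ₊₁⋯, n]`, on a basis element. -/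
noncomputable def deconc (p : WIdx) : WSpace k ⊗[k] WSpace k :=
  ∑ i ∈ Finset.range (p.1.1.length + 1),
    (Finsupp.single (⟨(p.1.1.take i, p.1.2),
        fun a ha => p.2 a (List.take_subset i p.1.1 ha)⟩ : WIdx) (1 : k)) ⊗ₜ[k]
    (Finsupp.single (⟨(p.1.1.drop i, p.1.2),
        fun a ha => p.2 a (List.drop_subset i p.1.1 ha)⟩ : WIdx) (1 : k))

/-- The deconcatenation coproduct `Δ⊙`. -/
noncomputable def comulW : WSpace k →ₗ[k] WSpace k ⊗[k] WSpace k :=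
  Finsupp.lift (WSpace k ⊗[k] WSpace k) k WIdx (deconc k)

/-- The unit element `[∅, 0]`. -/
noncomputable def unitW : WSpace k :=
  Finsupp.single ⟨(([] : Word), 0), by intro a ha; simp at ha⟩ 1

/-- The counit `ε`. -/
noncomputable def counitW : WSpace k →ₗ[k] k :=
  Finsupp.lift k k WIdx fun p => if p.1.1 = [] then 1 else 0

/-- The degree-`d` homogeneous component of `W` (spanned by basis elements
`[w,n]` with `ℓ(w) = d`). -/
noncomputable def Wdeg (d : ℕ) : Submodule k (WSpace k) :=
  Submodule.span k {f : WSpace k | ∃ p : WIdx, p.1.1.length = d ∧ f = Finsupp.single p 1}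


def wDown (m : ℕ) (w : Word) : Word :=
  w.filterMap fun (a : ℕ+) =>
    if h : m < (a : ℕ) then some ⟨(a : ℕ) - m, Nat.sub_pos_of_lt h⟩ else none

/-- Two words have the same set of letters. -/
def SameLetters (v w : Word) : Prop := v.toFinset = w.toFinset

/-- A word relation: an equivalence relation on words such that related words
have the same set of letters. -/
structure IsWordRel (r : Word → Word → Prop) : Prop where
  equiv : Equivalence r
  letters : ∀ v w, r v w → SameLetters v w

/-- `(w ∩ I) ↓ m` for the interval `I = {m+1, ..., n}`. -/
noncomputable def intervalDown (m n : ℕ) (w : Word) : Word :=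
  wDown m (wRestrict w {a : ℕ+ | m < (a : ℕ) ∧ (a : ℕ) ≤ n})

/-- An algebraic word relation. -/
structure IsAlgebraicRel (r : Word → Word → Prop) extends IsWordRel r : Prop where
  concat : ∀ v v' w w', r v v' → r w w' → r (v ++ w) (v' ++ w')
  restrict : ∀ v w, r v w → ∀ m n : ℕ, r (intervalDown m n v) (intervalDown m n w)

/-- A homogeneous word relation relates only words of the same length. -/
def IsHomogeneous (r : Word → Word → Prop) : Prop :=
  ∀ v w, r v w → v.length = w.length

/-- A word of minimal length in its `r`-equivalence class. -/
def IsReducedWord (r : Word → Word → Prop) (w : Word) : Prop :=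
  ∀ u, r u w → w.length ≤ u.length

/-- `W_R^(~)`: the span of the reduced basis elements `[w,n]`. -/
noncomputable def WR (r : Word → Word → Prop) : Submodule k (WSpace k) :=
  Submodule.span k {f : WSpace k | ∃ p : WIdx,
    IsReducedWord r p.1.1 ∧ f = Finsupp.single p 1}

variable {k}

/-- `κ_E^n = Σ_{w ∈ E} [w,n]`, for `E` the set of reduced words in the
`r`-equivalence class of `w₀`. -/
noncomputable def kappaR (r : Word → Word → Prop) (n : ℕ) (w₀ : Word) : WSpace k :=
  ∑ᶠ (p : WIdx) (_ : p.1.2 = n ∧ r p.1.1 w₀ ∧ IsReducedWord r p.1.1),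
    Finsupp.single p 1

variable (k)

/-- `K_R^(~)`: the span of the sums of reduced classes. -/
noncomputable def KR (r : Word → Word → Prop) : Submodule k (WSpace k) :=
  Submodule.span k {f : WSpace k | ∃ (n : ℕ) (w₀ : Word),
    (∀ a ∈ w₀, (a : ℕ) ≤ n) ∧ f = kappaR r n w₀}

lemma mem_wRestrict {w : Word} {S : Set ℕ+} {a : ℕ+} : a ∈ wRestrict w S ↔ a ∈ w ∧ a ∈ S := by
  simp [wRestrict]

lemma wDown_cons_of_lt {m : ℕ} {a : ℕ+} (h : m < (a : ℕ)) (w : Word) :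
    wDown m (a :: w) = ⟨(a : ℕ) - m, Nat.sub_pos_of_lt h⟩ :: wDown m w := by
  exact List.filterMap_cons_some (dif_pos h)

lemma wDown_wUp (m : ℕ) (w : Word) : wDown m (wUp m w) = w := by
  induction w with
  | nil => rfl
  | cons a w ih =>
    have h : m < (((⟨(a : ℕ) + m, Nat.add_pos_left a.pos m⟩ : ℕ+)) : ℕ) := by
      simp
    change wDown m (_ :: wUp m w) = _
    rw [wDown_cons_of_lt h, ih]
    congr 1
    apply PNat.eq
    simp

lemma wUp_wDown (m : ℕ) (w : Word) (hw : ∀ a ∈ w, m < (a : ℕ)) : wUp m (wDown m w) = w := by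
  induction w with
  | nil => rfl
  | cons a w ih =>
    have h := hw a (by simp)
    rw [wDown_cons_of_lt h]
    change _ :: wUp m (wDown m w) = _
    rw [ih fun b hb => hw b (by simp [hb])]
    congr 1
    apply PNat.eq
    simp only [PNat.mk_coe]
    omega

lemma length_wUp (m : ℕ) (w : Word) : (wUp m w).length = w.length :=
  List.length_map _

lemma wUp_intervalDown (m n : ℕ) (u : Word) :
    wUp m (intervalDown m n u) = wRestrict u {a : ℕ+ | m < (a : ℕ) ∧ (a : ℕ) ≤ n} :=
  wUp_wDown _ _ fun _ ha => (mem_wRestrict.1 ha).2.1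

lemma intervalDown_zero (m : ℕ) (u : Word) :
    intervalDown 0 m u = wRestrict u {a : ℕ+ | (a : ℕ) ≤ m} := by
  have h := wUp_intervalDown 0 m u
  have h0 : ∀ w : Word, wUp 0 w = w := fun w => by
    rw [← wDown_wUp 0 (wUp 0 w), wDown_wUp]
    exact List.map_id w
  rw [h0] at h
  simpa using h

lemma intervalDown_le {m n : ℕ} {u : Word} {a : ℕ+} (ha : a ∈ intervalDown m (m + n) u) :
    (a : ℕ) ≤ n := by
  have hmem : (⟨(a : ℕ) + m, Nat.add_pos_left a.pos m⟩ : ℕ+) ∈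
      wUp m (intervalDown m (m + n) u) := List.mem_map_of_mem ha
  rw [wUp_intervalDown] at hmem
  have h := (mem_wRestrict.1 hmem).2.2
  simp only [PNat.mk_coe] at h
  omega

lemma length_intervalDown_add {m n : ℕ} {u : Word} (hu : ∀ a ∈ u, (a : ℕ) ≤ m + n) :
    u.length = (intervalDown 0 m u).length + (intervalDown m (m + n) u).length := by
  rw [intervalDown_zero, ← length_wUp m (intervalDown m (m + n) u), wUp_intervalDown]
  induction u with
  | nil => simp [wRestrict]
  | cons a u ih =>
    have ih := ih fun b hb => hu b (by simp [hb])
    have ha := hu a (by simp)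
    by_cases h : (a : ℕ) ≤ m
    · have h' : ¬ m < (a : ℕ) := by omega
      simp [wRestrict, h, h'] at ih ⊢
      omega
    · have h' : m < (a : ℕ) := by omega
      simp [wRestrict, h', ha] at ih ⊢
      omega

lemma isShuffle_iff {m n : ℕ} {v w u : Word} (hu : ∀ a ∈ u, (a : ℕ) ≤ m + n) :
    IsShuffle m n v w u ↔ intervalDown 0 m u = v ∧ intervalDown m (m + n) u = w := by
  constructor
  · rintro ⟨h1, h2, -⟩
    refine ⟨(intervalDown_zero m u).trans h1, ?_⟩
    rw [intervalDown, h2, wDown_wUp]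
  · rintro ⟨rfl, rfl⟩
    exact ⟨(intervalDown_zero m u).symm, (wUp_intervalDown m (m + n) u).symm,
      length_intervalDown_add hu⟩

lemma SameLetters.mem_iff {v w : Word} (h : SameLetters v w) (a : ℕ+) : a ∈ v ↔ a ∈ w := by
  rw [← List.mem_toFinset, h, List.mem_toFinset]

section Reduced

variable {r : Word → Word → Prop}

lemma IsAlgebraicRel.le_of_rel (h : IsAlgebraicRel r) {v w : Word} {n : ℕ} (hvw : r v w)
    (hw : ∀ a ∈ w, (a : ℕ) ≤ n) : ∀ a ∈ v, (a : ℕ) ≤ n :=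
  fun a ha => hw a (((h.letters v w hvw).mem_iff a).1 ha)

lemma IsReducedWord.of_length_le {v w : Word} (h : IsAlgebraicRel r) (hw : IsReducedWord r w)
    (hvw : r v w) (hl : v.length ≤ w.length) : IsReducedWord r v :=
  fun u hu => hl.trans (hw u (h.equiv.trans hu hvw))

lemma IsReducedWord.length_eq {v w : Word} (h : IsAlgebraicRel r) (hv : IsReducedWord r v)
    (hw : IsReducedWord r w) (hvw : r v w) : v.length = w.length :=
  le_antisymm (hv w (h.equiv.symm hvw)) (hw v hvw)

lemma IsReducedWord.of_append {v w : Word} (h : IsAlgebraicRel r)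
    (hr : IsReducedWord r (v ++ w)) : IsReducedWord r v ∧ IsReducedWord r w := by
  constructor
  · intro u hu
    have := hr _ (h.concat _ _ _ _ hu (h.equiv.refl w))
    simpa using this
  · intro u hu
    have := hr _ (h.concat _ _ _ _ (h.equiv.refl v) hu)
    simpa using this

lemma IsReducedWord.of_intervalDown {m n : ℕ} {u : Word} (h : IsAlgebraicRel r)
    (hu : ∀ a ∈ u, (a : ℕ) ≤ m + n) (hv : IsReducedWord r (intervalDown 0 m u))
    (hw : IsReducedWord r (intervalDown m (m + n) u)) : IsReducedWord r u := by
  intro x hx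
  rw [length_intervalDown_add hu, length_intervalDown_add (h.le_of_rel hx hu)]
  exact add_le_add (hv _ (h.restrict _ _ hx _ _)) (hw _ (h.restrict _ _ hx _ _))

/-- The restrictions of a reduced word to `{1,…,m}` and `{m+1,…,m+n}` are reduced as soon as
those of some equivalent word are. -/
lemma IsReducedWord.intervalDown_of_rel {m n : ℕ} {x u : Word} (h : IsAlgebraicRel r)
    (hu : ∀ a ∈ u, (a : ℕ) ≤ m + n) (hv : IsReducedWord r (intervalDown 0 m u))
    (hw : IsReducedWord r (intervalDown m (m + n) u)) (hxu : r x u) (hx : IsReducedWord r x) :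
    IsReducedWord r (intervalDown 0 m x) ∧ IsReducedWord r (intervalDown m (m + n) x) := by
  have hlen := hx u (h.equiv.symm hxu)
  rw [length_intervalDown_add hu, length_intervalDown_add (h.le_of_rel hxu hu)] at hlen
  have h1 := h.restrict _ _ hxu 0 m
  have h2 := h.restrict _ _ hxu m (m + n)
  have h3 := hv _ h1
  have h4 := hw _ h2
  exact ⟨hv.of_length_le h h1 (by omega), hw.of_length_le h h2 (by omega)⟩

end Reduced

lemma finite_wIdx_of_length_le (n d : ℕ) :
    {p : WIdx | p.1.2 = n ∧ p.1.1.length ≤ d}.Finite := by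
  have hf : Finite {a : ℕ+ // (a : ℕ) ≤ n} :=
    Finite.of_injective (fun a => (⟨(a.1 : ℕ), Nat.lt_succ_of_le a.2⟩ : Fin (n + 1)))
      fun a b hab => Subtype.ext (PNat.eq (by simpa using hab))
  refine ((List.finite_length_le {a : ℕ+ // (a : ℕ) ≤ n} d).image
    fun l => (⟨(l.map Subtype.val, n), ?_⟩ : WIdx)).subset ?_
  · intro a ha
    obtain ⟨b, -, rfl⟩ := List.mem_map.1 ha
    exact b.2
  · rintro ⟨⟨w, n'⟩, hw⟩ ⟨rfl, hd⟩
    dsimp only at hw hd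
    lift w to List {a : ℕ+ // (a : ℕ) ≤ n'} using hw
    exact ⟨w, by simpa using hd, rfl⟩

/-- The basis elements `[u, m + n]` for `u` a shuffle of `p` and `q`. -/
def shuffles (p q : WIdx) : Set WIdx :=
  {u | u.1.2 = p.1.2 + q.1.2 ∧ IsShuffle p.1.2 q.1.2 p.1.1 q.1.1 u.1.1}

lemma finite_shuffles (p q : WIdx) : (shuffles p q).Finite :=
  (finite_wIdx_of_length_le (p.1.2 + q.1.2) (p.1.1.length + q.1.1.length)).subset
    fun _ hu => ⟨hu.1, hu.2.2.2.le⟩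

lemma mem_shuffles_iff {p q u : WIdx} : u ∈ shuffles p q ↔ u.1.2 = p.1.2 + q.1.2 ∧
    intervalDown 0 p.1.2 u.1.1 = p.1.1 ∧
    intervalDown p.1.2 (p.1.2 + q.1.2) u.1.1 = q.1.1 :=
  and_congr_right fun h => isShuffle_iff fun a ha => h ▸ u.2 a ha

lemma shufProd_eq_sum (p q : WIdx) :
    shufProd k p q = ∑ u ∈ (finite_shuffles p q).toFinset, Finsupp.single u (1 : k) :=
  finsum_mem_eq_finite_toFinset_sum _ (finite_shuffles p q)

lemma mulW_single (p q : WIdx) :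
    mulW k (Finsupp.single p 1) (Finsupp.single q 1) = shufProd k p q := by
  simp [mulW]

lemma comulW_single (p : WIdx) : comulW k (Finsupp.single p 1) = deconc k p := by
  simp [comulW]

/-- The reduced words, as elements `[w, n]`, equivalent to `w₀`. -/
def reducedClass (r : Word → Word → Prop) (n : ℕ) (w₀ : Word) : Set WIdx :=
  {p | p.1.2 = n ∧ r p.1.1 w₀ ∧ IsReducedWord r p.1.1}

section Classes

variable {r : Word → Word → Prop}

lemma finite_reducedClass (h : IsAlgebraicRel r) (n : ℕ) (w₀ : Word) : (reducedClass r n w₀).Finite :=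
  (finite_wIdx_of_length_le n w₀.length).subset
    fun _ hp => ⟨hp.1, hp.2.2 _ (h.equiv.symm hp.2.1)⟩

lemma kappaR_eq_sum (h : IsAlgebraicRel r) (n : ℕ) (w₀ : Word) :
    kappaR r n w₀ = ∑ p ∈ (finite_reducedClass h n w₀).toFinset, Finsupp.single p (1 : k) :=
  finsum_mem_eq_finite_toFinset_sum _ (finite_reducedClass h n w₀)

lemma kappaR_mem_KR (p : WIdx) : kappaR r p.1.2 p.1.1 ∈ KR k r :=
  Submodule.subset_span ⟨_, _, p.2, rfl⟩

/-- Equality of `n` and equivalence of words, as a setoid on the basis. -/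
def IsAlgebraicRel.setoid (h : IsAlgebraicRel r) : Setoid WIdx where
  r p q := p.1.2 = q.1.2 ∧ r p.1.1 q.1.1
  iseqv := ⟨fun _ => ⟨rfl, h.equiv.refl _⟩, fun hp => ⟨hp.1.symm, h.equiv.symm hp.2⟩,
    fun hp hq => ⟨hp.1.trans hq.1, h.equiv.trans hp.2 hq.2⟩⟩

end Classes

open Classical in
lemma Submodule.sum_mem_of_sum_class_mem {R M ι : Type*} [Semiring R] [AddCommMonoid M]
    [Module R M] (N : Submodule R M) (s : Setoid ι) (T : Finset ι) (g : ι → M)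
    (hT : ∀ i ∈ T, ∑ j ∈ T with s j i, g j ∈ N) : ∑ i ∈ T, g i ∈ N := by
  rw [Finset.sum_partition s (f := g)]
  refine N.sum_mem fun x hx => ?_
  obtain ⟨i, hi, rfl⟩ := Finset.mem_image.1 hx
  simpa only [_root_.Quotient.eq] using hT i hi

section Subbialgebra

variable {r : Word → Word → Prop}

lemma unitW_mem_WR : unitW k ∈ WR k r :=
  Submodule.subset_span ⟨_, fun _ _ => Nat.zero_le _, rfl⟩

lemma unitW_mem_KR (h : IsAlgebraicRel r) : unitW k ∈ KR k r := by
  refine Submodule.subset_span ⟨0, [], by simp, ?_⟩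
  rw [kappaR_eq_sum k h]
  let e : WIdx := ⟨(([] : Word), 0), by simp⟩
  have : (finite_reducedClass h 0 []).toFinset = {e} := by
    ext p
    rw [Set.Finite.mem_toFinset, Finset.mem_singleton]
    constructor
    · rintro ⟨hn, -, -⟩
      have hw : p.1.1 = [] := List.eq_nil_iff_forall_not_mem.2 fun a ha =>
        absurd (hn ▸ p.2 a ha) (by simp)
      exact Subtype.ext (Prod.ext hw hn)
    · rintro rfl
      exact ⟨rfl, h.equiv.refl _, fun _ _ => Nat.zero_le _⟩
  rw [this, Finset.sum_singleton]
  rfl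

lemma Submodule.span_bilin_mem {R M : Type*} [CommRing R] [AddCommGroup M] [Module R M]
    (f : M →ₗ[R] M →ₗ[R] M) (S : Set M) (hS : ∀ x ∈ S, ∀ y ∈ S, f x y ∈ Submodule.span R S) :
    ∀ x ∈ Submodule.span R S, ∀ y ∈ Submodule.span R S, f x y ∈ Submodule.span R S := by
  intro x hx y hy
  have hxy := Submodule.apply_mem_map₂ f hx hy
  rw [Submodule.map₂_span_span] at hxy
  exact Submodule.span_le.2 (Set.image2_subset_iff.2 hS) hxy

lemma mulW_mem_WR (h : IsAlgebraicRel r) :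
    ∀ x ∈ WR k r, ∀ y ∈ WR k r, mulW k x y ∈ WR k r := by
  refine Submodule.span_bilin_mem _ _ ?_
  rintro _ ⟨p, hp, rfl⟩ _ ⟨q, hq, rfl⟩
  rw [mulW_single, shufProd_eq_sum]
  refine Submodule.sum_mem _ fun u hu => Submodule.subset_span ⟨u, ?_, rfl⟩
  obtain ⟨hn, h1, h2⟩ := mem_shuffles_iff.1 ((Set.Finite.mem_toFinset _).1 hu)
  exact IsReducedWord.of_intervalDown h (fun a ha => hn ▸ u.2 a ha) (h1 ▸ hp) (h2 ▸ hq)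

lemma comulW_mem_WR (h : IsAlgebraicRel r) : ∀ x ∈ WR k r, comulW k x ∈
    Submodule.span k {t : WSpace k ⊗[k] WSpace k |
      ∃ a ∈ WR k r, ∃ b ∈ WR k r, t = a ⊗ₜ[k] b} := by
  intro x hx
  induction hx using Submodule.span_induction with
  | zero => simp
  | add x y _ _ hx hy => rw [map_add]; exact add_mem hx hy
  | smul c x _ hx => rw [map_smul]; exact Submodule.smul_mem _ c hx
  | mem x hx =>
    obtain ⟨p, hp, rfl⟩ := hx
    rw [comulW_single]
    refine Submodule.sum_mem _ fun i _ => Submodule.subset_span ?_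
    rw [← List.take_append_drop i p.1.1] at hp
    have hp' := hp.of_append h
    exact ⟨_, Submodule.subset_span ⟨_, hp'.1, rfl⟩, _, Submodule.subset_span ⟨_, hp'.2, rfl⟩, rfl⟩

open Classical in
lemma mulW_mem_KR (h : IsAlgebraicRel r) :
    ∀ x ∈ KR k r, ∀ y ∈ KR k r, mulW k x y ∈ KR k r := by
  refine Submodule.span_bilin_mem _ _ ?_
  rintro _ ⟨m, v₀, -, rfl⟩ _ ⟨n, w₀, -, rfl⟩
  rw [kappaR_eq_sum k h, kappaR_eq_sum k h]
  set A := (finite_reducedClass h m v₀).toFinset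
  set B := (finite_reducedClass h n w₀).toFinset
  have hAmem : ∀ {p}, p ∈ A ↔ p ∈ reducedClass r m v₀ := Set.Finite.mem_toFinset _
  have hBmem : ∀ {p}, p ∈ B ↔ p ∈ reducedClass r n w₀ := Set.Finite.mem_toFinset _
  let sh : WIdx × WIdx → Finset WIdx := fun z => (finite_shuffles z.1 z.2).toFinset
  have hsh : ∀ {z u}, u ∈ sh z ↔ u ∈ shuffles z.1 z.2 := Set.Finite.mem_toFinset _
  have hdisj : ((A ×ˢ B : Finset (WIdx × WIdx)) : Set (WIdx × WIdx)).PairwiseDisjoint sh := by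
    rintro ⟨p, q⟩ hz ⟨p', q'⟩ hz' hne
    rw [Finset.mem_coe, Finset.mem_product, hAmem, hBmem] at hz hz'
    refine Finset.disjoint_left.2 fun u hu hu' => hne ?_
    obtain ⟨-, h1, h2⟩ := mem_shuffles_iff.1 (hsh.1 hu)
    obtain ⟨-, h1', h2'⟩ := mem_shuffles_iff.1 (hsh.1 hu')
    obtain ⟨⟨hp, -⟩, ⟨hq, -⟩⟩ := hz
    obtain ⟨⟨hp', -⟩, ⟨hq', -⟩⟩ := hz'
    dsimp only at hp hq hp' hq' h1 h2 h1' h2'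
    rw [hp] at h1 h2
    rw [hp'] at h1' h2'
    rw [hq] at h2
    rw [hq'] at h2'
    exact Prod.ext (Subtype.ext (Prod.ext (h1.symm.trans h1') (hp.trans hp'.symm)))
      (Subtype.ext (Prod.ext (h2.symm.trans h2') (hq.trans hq'.symm)))
  have hsum : mulW k (∑ p ∈ A, Finsupp.single p (1 : k)) (∑ p ∈ B, Finsupp.single p (1 : k)) =
      ∑ u ∈ (A ×ˢ B).biUnion sh, Finsupp.single u (1 : k) := by
    rw [Finset.sum_biUnion hdisj, Finset.sum_product]
    simp only [map_sum, LinearMap.sum_apply, mulW_single, shufProd_eq_sum]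
    rw [Finset.sum_comm]
  have hmem : ∀ {u}, u ∈ (A ×ˢ B).biUnion sh ↔ ∃ p ∈ reducedClass r m v₀,
      ∃ q ∈ reducedClass r n w₀, u ∈ shuffles p q := by
    intro u
    simp only [Finset.mem_biUnion, Finset.mem_product, Prod.exists, hAmem, hBmem, hsh]
    tauto
  rw [hsum]
  refine Submodule.sum_mem_of_sum_class_mem (KR k r) h.setoid _ _ fun u hu => ?_
  have hu' := kappaR_mem_KR k (r := r) u
  rw [kappaR_eq_sum k h u.1.2 u.1.1] at hu'
  convert hu' using 1
  refine Finset.sum_congr (M := WSpace k) (Finset.ext fun x => ?_) fun _ _ => rfl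
  rw [Finset.mem_filter, Set.Finite.mem_toFinset]
  constructor
  · rintro ⟨hx, hxn, hxr⟩
    refine ⟨hxn, hxr, ?_⟩
    obtain ⟨p, ⟨-, -, hp⟩, q, ⟨-, -, hq⟩, hs⟩ := hmem.1 hx
    obtain ⟨hn, h1, h2⟩ := mem_shuffles_iff.1 hs
    exact IsReducedWord.of_intervalDown h (fun a ha => hn ▸ x.2 a ha) (h1 ▸ hp) (h2 ▸ hq)
  · rintro ⟨hxn, hxr, hxred⟩
    refine ⟨hmem.2 ?_, hxn, hxr⟩
    obtain ⟨p, ⟨rfl, hpv, hp⟩, q, ⟨rfl, hqw, hq⟩, hs⟩ := hmem.1 hu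
    obtain ⟨hn, h1, h2⟩ := mem_shuffles_iff.1 hs
    rw [← h1] at hp hpv
    rw [← h2] at hq hqw
    obtain ⟨hp', hq'⟩ := IsReducedWord.intervalDown_of_rel h
      (fun a ha => hn ▸ u.2 a ha) hp hq hxr hxred
    refine ⟨⟨(intervalDown 0 p.1.2 x.1.1, p.1.2), fun a ha => ?_⟩,
      ⟨rfl, h.equiv.trans (h.restrict _ _ hxr _ _) hpv, hp'⟩,
      ⟨(intervalDown p.1.2 (p.1.2 + q.1.2) x.1.1, q.1.2), fun a ha => intervalDown_le ha⟩,
      ⟨rfl, h.equiv.trans (h.restrict _ _ hxr _ _) hqw, hq'⟩,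
      mem_shuffles_iff.2 ⟨hxn.trans hn, rfl, rfl⟩⟩
    exact intervalDown_le (m := 0) (by simpa using ha)

/-- The splitting `([w₁⋯wᵢ, n], [wᵢ₊₁⋯, n])` of `[w, n]`. -/
def splitAt (p : WIdx) (i : ℕ) : WIdx × WIdx :=
  (⟨(p.1.1.take i, p.1.2), fun a ha => p.2 a (List.take_subset i p.1.1 ha)⟩,
    ⟨(p.1.1.drop i, p.1.2), fun a ha => p.2 a (List.drop_subset i p.1.1 ha)⟩)

open Classical in
lemma deconc_eq_sum (p : WIdx) : deconc k p =
    ∑ z ∈ (Finset.range (p.1.1.length + 1)).image (splitAt p),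
      Finsupp.single z.1 (1 : k) ⊗ₜ[k] Finsupp.single z.2 (1 : k) := by
  rw [Finset.sum_image]
  · rfl
  · intro i hi j hj hij
    have hl := congrArg (fun z : WIdx × WIdx => z.1.1.1.length) hij
    simp only [splitAt, List.length_take] at hl
    simp only [Finset.coe_range, Set.mem_Iio] at hi hj
    omega

open Classical in
lemma mem_image_splitAt {p : WIdx} {z : WIdx × WIdx} :
    z ∈ (Finset.range (p.1.1.length + 1)).image (splitAt p) ↔
      z.1.1.2 = p.1.2 ∧ z.2.1.2 = p.1.2 ∧ z.1.1.1 ++ z.2.1.1 = p.1.1 := by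
  rw [Finset.mem_image]
  constructor
  · rintro ⟨i, -, rfl⟩
    exact ⟨rfl, rfl, List.take_append_drop i p.1.1⟩
  · rintro ⟨h1, h2, h3⟩
    refine ⟨z.1.1.1.length, ?_, ?_⟩
    · rw [Finset.mem_range, ← h3, List.length_append]
      omega
    · exact Prod.ext (Subtype.ext (Prod.ext (by simp [splitAt, ← h3]) h1.symm))
        (Subtype.ext (Prod.ext (by simp [splitAt, ← h3]) h2.symm))

open Classical in
lemma comulW_mem_KR (h : IsAlgebraicRel r) : ∀ x ∈ KR k r, comulW k x ∈
    Submodule.span k {t : WSpace k ⊗[k] WSpace k |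
      ∃ a ∈ KR k r, ∃ b ∈ KR k r, t = a ⊗ₜ[k] b} := by
  intro x hx
  induction hx using Submodule.span_induction with
  | zero => simp
  | add x y _ _ hx hy => rw [map_add]; exact add_mem hx hy
  | smul c x _ hx => rw [map_smul]; exact Submodule.smul_mem _ c hx
  | mem x hx =>
    obtain ⟨n, w₀, -, rfl⟩ := hx
    rw [kappaR_eq_sum k h, map_sum]
    simp only [comulW_single, deconc_eq_sum]
    rw [← Finset.sum_biUnion]
    swap
    · intro p _ q _ hne
      refine Finset.disjoint_left.2 fun z hz hz' => hne ?_
      obtain ⟨h1, -, h2⟩ := mem_image_splitAt.1 hz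
      obtain ⟨h1', -, h2'⟩ := mem_image_splitAt.1 hz'
      exact Subtype.ext (Prod.ext (h2.symm.trans h2') (h1.symm.trans h1'))
    have hmem : ∀ {z}, z ∈ (finite_reducedClass h n w₀).toFinset.biUnion
        (fun p => (Finset.range (p.1.1.length + 1)).image (splitAt p)) ↔
        z.1.1.2 = n ∧ z.2.1.2 = n ∧ r (z.1.1.1 ++ z.2.1.1) w₀ ∧
          IsReducedWord r (z.1.1.1 ++ z.2.1.1) := by
      intro z
      simp only [Finset.mem_biUnion, Set.Finite.mem_toFinset, mem_image_splitAt]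
      constructor
      · rintro ⟨p, ⟨rfl, hp⟩, h1, h2, h3⟩
        rw [h3]
        exact ⟨h1, h2, hp⟩
      · rintro ⟨h1, h2, hz⟩
        refine ⟨⟨(z.1.1.1 ++ z.2.1.1, n), fun a ha => ?_⟩, ⟨rfl, hz⟩, h1, h2, rfl⟩
        exact (List.mem_append.1 ha).elim (fun ha => h1 ▸ z.1.2 a ha) fun ha => h2 ▸ z.2.2 a ha
    refine Submodule.sum_mem_of_sum_class_mem _ (h.setoid.prod h.setoid) _ _ fun z hz => ?_
    refine Submodule.subset_span ⟨_, kappaR_mem_KR k (r := r) z.1, _,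
      kappaR_mem_KR k (r := r) z.2, ?_⟩
    rw [kappaR_eq_sum k h, kappaR_eq_sum k h, TensorProduct.sum_tmul]
    simp only [TensorProduct.tmul_sum]
    rw [← Finset.sum_product']
    refine Finset.sum_congr (Finset.ext fun y => ?_) fun _ _ => rfl
    rw [Finset.mem_filter, Finset.mem_product, Set.Finite.mem_toFinset, Set.Finite.mem_toFinset,
      hmem]
    obtain ⟨hz1, hz2, hzr, hzred⟩ := hmem.1 hz
    constructor
    · rintro ⟨⟨-, -, -, hy⟩, ⟨hn1, hr1⟩, ⟨hn2, hr2⟩⟩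
      obtain ⟨hy1, hy2⟩ := hy.of_append h
      exact ⟨⟨hn1, hr1, hy1⟩, ⟨hn2, hr2, hy2⟩⟩
    · rintro ⟨⟨hn1, hr1, hy1⟩, ⟨hn2, hr2, hy2⟩⟩
      have hr := h.concat _ _ _ _ hr1 hr2
      obtain ⟨hzr1, hzr2⟩ := hzred.of_append h
      refine ⟨⟨hn1.trans hz1, hn2.trans hz2, h.equiv.trans hr hzr,
        hzred.of_length_le h hr ?_⟩, ⟨hn1, hr1⟩, ⟨hn2, hr2⟩⟩
      rw [List.length_append, List.length_append, hy1.length_eq h hzr1 hr1,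
        hy2.length_eq h hzr2 hr2]

end Subbialgebra

theorem stmt10 (r : Word → Word → Prop) (halg : IsAlgebraicRel r) :
    -- `W_R^(~)` is a sub-bialgebra of `W`
    (unitW k ∈ WR k r ∧
      (∀ x ∈ WR k r, ∀ y ∈ WR k r, mulW k x y ∈ WR k r) ∧
      (∀ x ∈ WR k r, comulW k x ∈
        Submodule.span k {t : WSpace k ⊗[k] WSpace k |
          ∃ a ∈ WR k r, ∃ b ∈ WR k r, t = a ⊗ₜ[k] b})) ∧
    -- `K_R^(~)` is a sub-bialgebra of `W`
    (unitW k ∈ KR k r ∧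
      (∀ x ∈ KR k r, ∀ y ∈ KR k r, mulW k x y ∈ KR k r) ∧
      (∀ x ∈ KR k r, comulW k x ∈
        Submodule.span k {t : WSpace k ⊗[k] WSpace k |
          ∃ a ∈ KR k r, ∃ b ∈ KR k r, t = a ⊗ₜ[k] b})) := by
  exact ⟨⟨unitW_mem_WR k, mulW_mem_WR k halg, comulW_mem_WR k halg⟩,
    unitW_mem_KR k halg, mulW_mem_KR k halg, comulW_mem_KR k halg⟩
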